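/- Let (Ω, F, P) be a probability space, (K, d) a compact metric space, β ∈ (0,1], and N a finite constant. Let X_n, X : Ω → (K → ℝ), n ∈ ℕ, be random fields such that for every x ∈ K the maps ω ↦ X_n(ω)(x) and ω ↦ X(ω)(x) are integrable random variables and E|X_n(x) − X(x)| → 0 as n → ∞. Suppose further that there exist nonnegative random variables H_n, H with E[(H_n + H)²] ≤ N for all n, such that almost surely |X_n(ω)(x) − X_n(ω)(y)| ≤ H_n(ω)·d(x,y)^β and |X(ω)(x) − X(ω)(y)| ≤ H(ω)·d(x,y)^β for all x, y ∈ K. Then there exists a strictly increasing subsequence (k(n))_{n∈ℕ} such that almost surely sup_{x ∈ K} |X_{k(n)}(ω)(x) − X(ω)(x)| → 0 as n → ∞. -/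

import Mathlib

open MeasureTheory Filter

open scoped ENNReal Topology

/-- If a sequence of (possibly non-measurable) functions has a.e. majorants of arbitrarily small
integral, then a subsequence tends to zero almost everywhere. -/
theorem exists_subseq_ae_tendsto_zero_of_small_majorants
    {Ω : Type*} [MeasurableSpace Ω] {μ : Measure Ω} {F : ℕ → Ω → ℝ≥0∞}
    (h : ∀ ε : ℝ≥0∞, ε ≠ 0 → ∀ᶠ n in atTop, ∃ G : Ω → ℝ≥0∞,
      AEMeasurable G μ ∧ ∫⁻ ω, G ω ∂μ ≤ ε ∧ ∀ᵐ ω ∂μ, F n ω ≤ G ω) :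
    ∃ k : ℕ → ℕ, StrictMono k ∧ ∀ᵐ ω ∂μ, Tendsto (fun n => F (k n) ω) atTop (𝓝 0) := by
  obtain ⟨ε, hε, hsum⟩ := ENNReal.exists_pos_sum_of_countable' one_ne_zero ℕ
  obtain ⟨k, hk, hG⟩ := extraction_forall_of_eventually (fun m => h (ε m) (hε m).ne')
  choose G hGm hGi hFG using hG
  refine ⟨k, hk, ?_⟩
  have hfin : ∫⁻ ω, ∑' m, G m ω ∂μ ≠ ∞ := by
    rw [lintegral_tsum hGm]
    exact ((ENNReal.tsum_le_tsum hGi).trans_lt (hsum.trans ENNReal.one_lt_top)).ne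
  filter_upwards [ae_lt_top' (AEMeasurable.tsum hGm) hfin, ae_all_iff.2 hFG]
    with ω hω hle
  exact tendsto_of_tendsto_of_tendsto_of_le_of_le tendsto_const_nhds
    (ENNReal.tendsto_atTop_zero_of_tsum_ne_top hω.ne) (fun _ => zero_le) hle

/-- On a finite net of mesh `δ`, a `β`-Hölder function is controlled by its values on the net. -/
theorem enorm_le_holder_add_sum_net {K : Type*} [PseudoMetricSpace K] {β δ L : ℝ} (hβ : 0 ≤ β)
    (hL : 0 ≤ L) {f : K → ℝ} (hf : ∀ x y, |f x - f y| ≤ L * dist x y ^ β)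
    {Λ : Finset K} (hΛ : ∀ x, ∃ y ∈ Λ, dist x y ≤ δ) (x : K) :
    ‖f x‖ₑ ≤ ENNReal.ofReal L * ENNReal.ofReal (δ ^ β) + ∑ y ∈ Λ, ‖f y‖ₑ := by
  obtain ⟨y, hy, hxy⟩ := hΛ x
  have hdiff : ‖f x - f y‖ₑ ≤ ENNReal.ofReal L * ENNReal.ofReal (δ ^ β) := by
    rw [← ENNReal.ofReal_mul hL, Real.enorm_eq_ofReal_abs]
    exact ENNReal.ofReal_le_ofReal ((hf x y).trans (by gcongr))
  calc ‖f x‖ₑ = ‖(f x - f y) + f y‖ₑ := by rw [sub_add_cancel]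
    _ ≤ ‖f x - f y‖ₑ + ‖f y‖ₑ := enorm_add_le _ _
    _ ≤ _ := add_le_add hdiff (Finset.single_le_sum (f := fun y => ‖f y‖ₑ)
      (fun _ _ => zero_le) hy)

/-- Random fields on a compact space that tend to zero pointwise in `L¹` and have Hölder seminorms
bounded in `L¹` have uniform norms with majorants of arbitrarily small integral. -/
theorem eventually_exists_small_majorant_iSup_enorm
    {Ω : Type*} [MeasurableSpace Ω] {μ : Measure Ω} {K : Type*} [PseudoMetricSpace K]
    [CompactSpace K] {β : ℝ} (hβ : 0 < β) {Y : ℕ → Ω → K → ℝ} {L : ℕ → Ω → ℝ} {C : ℝ≥0∞}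
    (hC : C ≠ ∞) (hY : ∀ n x, AEMeasurable (fun ω => Y n ω x) μ)
    (hY0 : ∀ x, Tendsto (fun n => ∫⁻ ω, ‖Y n ω x‖ₑ ∂μ) atTop (𝓝 0))
    (hLm : ∀ n, AEMeasurable (L n) μ) (hL : ∀ n ω, 0 ≤ L n ω)
    (hLC : ∀ n, ∫⁻ ω, ENNReal.ofReal (L n ω) ∂μ ≤ C)
    (hHolder : ∀ n, ∀ᵐ ω ∂μ, ∀ x y, |Y n ω x - Y n ω y| ≤ L n ω * dist x y ^ β)
    {ε : ℝ≥0∞} (hε : ε ≠ 0) :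
    ∀ᶠ n in atTop, ∃ G : Ω → ℝ≥0∞,
      AEMeasurable G μ ∧ ∫⁻ ω, G ω ∂μ ≤ ε ∧ ∀ᵐ ω ∂μ, ⨆ x, ‖Y n ω x‖ₑ ≤ G ω := by
  have hε2 : 0 < ε / 2 := ENNReal.half_pos hε
  obtain ⟨δ, hδε, hδ⟩ : ∃ δ : ℝ, C * ENNReal.ofReal (δ ^ β) < ε / 2 ∧ 0 < δ := by
    have hlim : Tendsto (fun δ : ℝ => C * ENNReal.ofReal (δ ^ β)) (𝓝[>] 0) (𝓝 0) := by
      have hpow : Tendsto (fun δ : ℝ => δ ^ β) (𝓝[>] 0) (𝓝 0) := by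
        simpa [Real.zero_rpow hβ.ne'] using
          ((Real.continuousAt_rpow_const 0 β (Or.inr hβ.le)).tendsto.mono_left
            nhdsWithin_le_nhds)
      simpa using ENNReal.Tendsto.const_mul (ENNReal.tendsto_ofReal hpow) (Or.inr hC)
    exact ((hlim.eventually_lt_const hε2).and self_mem_nhdsWithin).exists
  obtain ⟨t, -, ht, hcover⟩ := (isCompact_univ (X := K)).finite_cover_balls hδ
  have hnet : ∀ x, ∃ y ∈ ht.toFinset, dist x y ≤ δ := fun x => by
    obtain ⟨y, hy, hxy⟩ := Set.mem_iUnion₂.1 (hcover (Set.mem_univ x))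
    exact ⟨y, ht.mem_toFinset.2 hy, (Metric.mem_ball.1 hxy).le⟩
  have hsum : Tendsto (fun n => ∑ y ∈ ht.toFinset, ∫⁻ ω, ‖Y n ω y‖ₑ ∂μ) atTop (𝓝 0) := by
    simpa using tendsto_finsetSum ht.toFinset (fun y _ => hY0 y)
  filter_upwards [hsum.eventually_lt_const hε2] with n hn
  refine ⟨fun ω => ENNReal.ofReal (L n ω) * ENNReal.ofReal (δ ^ β)
    + ∑ y ∈ ht.toFinset, ‖Y n ω y‖ₑ, ?_, ?_, ?_⟩
  · exact ((hLm n).ennreal_ofReal.mul_const _).add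
      (Finset.aemeasurable_fun_sum _ fun y _ => (hY n y).enorm)
  · rw [lintegral_add_left' ((hLm n).ennreal_ofReal.mul_const _),
      lintegral_mul_const' _ _ ENNReal.ofReal_ne_top,
      lintegral_finsetSum' _ fun y _ => (hY n y).enorm, ← ENNReal.add_halves ε]
    exact add_le_add ((mul_le_mul_left (hLC n) _).trans hδε.le) hn.le
  · filter_upwards [hHolder n] with ω hω
    exact iSup_le (enorm_le_holder_add_sum_net hβ.le (hL n ω) hω hnet)

/-- Convergence of the extended uniform norms implies convergence of the real ones. -/
theorem tendsto_iSup_abs_of_tendsto_iSup_enorm {ι K : Type*} {l : Filter ι} [Nonempty K]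
    {f : ι → K → ℝ} (h : Tendsto (fun i => ⨆ x, ‖f i x‖ₑ) l (𝓝 0)) :
    Tendsto (fun i => ⨆ x, |f i x|) l (𝓝 0) := by
  have hreal : Tendsto (fun i => (⨆ x, ‖f i x‖ₑ).toReal) l (𝓝 0) := by
    simpa [Function.comp_def] using (ENNReal.tendsto_toReal ENNReal.zero_ne_top).comp h
  refine squeeze_zero' (.of_forall fun i => Real.iSup_nonneg fun x => abs_nonneg _) ?_ hreal
  filter_upwards [h.eventually_lt_const ENNReal.zero_lt_top] with i hi
  refine ciSup_le fun x => ?_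
  simpa using ENNReal.toReal_mono hi.ne (le_iSup (fun x => ‖f i x‖ₑ) x)

/-- On a probability space the second moment controls the first one. -/
theorem lintegral_ofReal_le_one_add_sq {Ω : Type*} [MeasurableSpace Ω] (μ : Measure Ω)
    [IsProbabilityMeasure μ] (f : Ω → ℝ) :
    ∫⁻ ω, ENNReal.ofReal (f ω) ∂μ ≤ 1 + ∫⁻ ω, ENNReal.ofReal (f ω ^ 2) ∂μ := by
  calc ∫⁻ ω, ENNReal.ofReal (f ω) ∂μ ≤ ∫⁻ ω, (1 + ENNReal.ofReal (f ω ^ 2)) ∂μ := by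
        refine lintegral_mono fun ω => ?_
        rw [← ENNReal.ofReal_one, ← ENNReal.ofReal_add zero_le_one (sq_nonneg _)]
        exact ENNReal.ofReal_le_ofReal (by nlinarith [sq_nonneg (f ω - 1)])
    _ = _ := by rw [lintegral_add_left measurable_const]; simp

/-- **Uniform a.s. convergence along a subsequence from `L¹` pointwise convergence and
uniform Hölder-seminorm moment bounds.**
Let `(K, d)` be a compact metric space, `β ∈ (0,1]`, and `N < ∞`.  Let `X n, X₀` be random
fields on `K` whose evaluations are integrable, with `E|X n (x) - X₀ (x)| → 0` for every
`x ∈ K`.  Assume there are nonnegative random variables `H n, H₀` with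
`E[(H n + H₀)²] ≤ N` for all `n`, such that almost surely
`|X n ω x - X n ω y| ≤ H n ω * d(x,y)^β` and `|X₀ ω x - X₀ ω y| ≤ H₀ ω * d(x,y)^β`
for all `x, y ∈ K`.  Then along some strictly increasing subsequence `k`,
`sup_{x ∈ K} |X (k n) ω x - X₀ ω x| → 0` almost surely. -/
theorem ae_uniform_tendsto_subseq_of_L1_and_holder_moment
    {Ω : Type*} [MeasurableSpace Ω] (P : Measure Ω) [IsProbabilityMeasure P]
    {K : Type*} [MetricSpace K] [CompactSpace K] [Nonempty K]
    (β : ℝ) (hβ0 : 0 < β) (hβ1 : β ≤ 1) (N : ℝ)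
    (X : ℕ → Ω → K → ℝ) (X₀ : Ω → K → ℝ)
    (hXint : ∀ n x, Integrable (fun ω => X n ω x) P)
    (hX₀int : ∀ x, Integrable (fun ω => X₀ ω x) P)
    (hL1 : ∀ x : K, Tendsto (fun n => ∫ ω, |X n ω x - X₀ ω x| ∂P) atTop (nhds 0))
    (H : ℕ → Ω → ℝ) (H₀ : Ω → ℝ)
    (hHmeas : ∀ n, Measurable (H n)) (hH₀meas : Measurable H₀)
    (hHnn : ∀ n ω, 0 ≤ H n ω) (hH₀nn : ∀ ω, 0 ≤ H₀ ω)
    (hmom : ∀ n, ∫⁻ ω, ENNReal.ofReal ((H n ω + H₀ ω) ^ 2) ∂P ≤ ENNReal.ofReal N)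
    (hHolder : ∀ n, ∀ᵐ ω ∂P, ∀ x y : K,
      |X n ω x - X n ω y| ≤ H n ω * dist x y ^ β)
    (hHolder₀ : ∀ᵐ ω ∂P, ∀ x y : K,
      |X₀ ω x - X₀ ω y| ≤ H₀ ω * dist x y ^ β) :
    ∃ k : ℕ → ℕ, StrictMono k ∧
      ∀ᵐ ω ∂P, Tendsto (fun n => ⨆ x : K, |X (k n) ω x - X₀ ω x|) atTop (nhds 0) := by
  obtain ⟨k, hk, hlim⟩ := exists_subseq_ae_tendsto_zero_of_small_majorants (μ := P)
    (F := fun n ω => ⨆ x, ‖X n ω x - X₀ ω x‖ₑ) fun ε hε =>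
      eventually_exists_small_majorant_iSup_enorm hβ0 (L := fun n ω => H n ω + H₀ ω)
        (C := 1 + ENNReal.ofReal N) (by finiteness)
        (fun n x => ((hXint n x).sub (hX₀int x)).aemeasurable)
        (fun x => by
          have hnorm : ∀ n, ∫⁻ ω, ‖X n ω x - X₀ ω x‖ₑ ∂P
              = ENNReal.ofReal (∫ ω, |X n ω x - X₀ ω x| ∂P) := fun n =>
            (ofReal_integral_norm_eq_lintegral_enorm ((hXint n x).sub (hX₀int x))).symm
          simpa [hnorm] using ENNReal.tendsto_ofReal (hL1 x))
        (fun n => ((hHmeas n).add hH₀meas).aemeasurable)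
        (fun n ω => add_nonneg (hHnn n ω) (hH₀nn ω))
        (fun n => (lintegral_ofReal_le_one_add_sq P _).trans (by gcongr; exact hmom n))
        (fun n => by
          filter_upwards [hHolder n, hHolder₀] with ω h h₀ x y
          calc |X n ω x - X₀ ω x - (X n ω y - X₀ ω y)|
              = |(X n ω x - X n ω y) - (X₀ ω x - X₀ ω y)| := by ring_nf
            _ ≤ |X n ω x - X n ω y| + |X₀ ω x - X₀ ω y| := abs_sub _ _
            _ ≤ (H n ω + H₀ ω) * dist x y ^ β := by linarith [h x y, h₀ x y])
        hε
  exact ⟨k, hk, hlim.mono fun ω hω => tendsto_iSup_abs_of_tendsto_iSup_enorm hω⟩
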